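/- Let T be a finite tree and let u, v be two adjacent vertices of T. Then C_T(u) ≤ C_T(v) if and only if |(T,v)_{u↓}| ≥ |(T,u)_{v↓}|, and likewise φ_T(u) ≤ φ_T(v) if and only if |(T,v)_{u↓}| ≥ |(T,u)_{v↓}|. In particular, C_T(v) = Σ_{u ∈ V(T)\{v}} |(T,v)_{u↓}|. -/

import Mathlib

open SimpleGraph Finset

variable {V : Type*} [Fintype V] [DecidableEq V]

/-- `(T,v)_{u↓}`: the set of vertices `w` whose unique path to `v` passes through `u`. -/
def subtreeSet (T : SimpleGraph V) (v u : V) : Set V :=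
  {w | ∀ p : T.Path w v, u ∈ p.1.support}

/-- `|(T,v)_{u↓}|` -/
noncomputable def subtreeCard (T : SimpleGraph V) (v u : V) : ℕ :=
  Nat.card (subtreeSet T v u)

/-- Closeness centrality `C_T(v) = Σ_{u ≠ v} dist(v,u)`; smaller is more central. -/
noncomputable def closeness (T : SimpleGraph V) (v : V) : ℕ :=
  ∑ u ∈ Finset.univ.erase v, T.dist v u

/-- Rumor centrality `φ_T(v) = Π_{u ≠ v} |(T,v)_{u↓}|`; smaller is more central. -/
noncomputable def rumor (T : SimpleGraph V) (v : V) : ℕ :=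
  ∏ u ∈ Finset.univ.erase v, subtreeCard T v u

omit [Fintype V] [DecidableEq V] in
theorem mem_subtreeSet_self (T : SimpleGraph V) (v u : V) : u ∈ subtreeSet T v u :=
  fun p => p.1.start_mem_support

omit [DecidableEq V] in
theorem subtreeCard_pos (T : SimpleGraph V) (v u : V) : 0 < subtreeCard T v u :=
  have : Nonempty (subtreeSet T v u) := ⟨u, mem_subtreeSet_self T v u⟩
  Nat.card_pos

omit [Fintype V] in
theorem subtreeSet_subset_of_adj {T : SimpleGraph V} {u v z : V} (h : T.Adj u v) (hz : z ≠ v) :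
    subtreeSet T v z ⊆ subtreeSet T u z := by
  intro w hw p
  have hmem := (p.1.concat h).support_bypass_subset_support (hw (p.1.concat h).toPath)
  simpa [Walk.support_concat, hz] using hmem

omit [Fintype V] in
theorem subtreeCard_eq_of_adj {T : SimpleGraph V} {u v z : V} (h : T.Adj u v)
    (hu : z ≠ u) (hv : z ≠ v) : subtreeCard T v z = subtreeCard T u z := by
  rw [subtreeCard, subtreeCard, (subtreeSet_subset_of_adj h hv).antisymm
    (subtreeSet_subset_of_adj h.symm hu)]

omit [Fintype V] [DecidableEq V] in
theorem SimpleGraph.IsTree.mem_subtreeSet_iff {T : SimpleGraph V} (hT : T.IsTree) {v z w : V}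
    (p : T.Path w v) : w ∈ subtreeSet T v z ↔ z ∈ p.1.support :=
  ⟨fun h => h p, fun h q => (hT.isAcyclic.subsingleton_path w v).elim p q ▸ h⟩

omit [Fintype V] in
theorem SimpleGraph.Walk.IsPath.card_support_erase_end {G : SimpleGraph V} {w v : V}
    {p : G.Walk w v} (hp : p.IsPath) : #(p.support.toFinset.erase v) = p.length := by
  rw [Finset.card_erase_of_mem (by simp), List.toFinset_card_of_nodup hp.support_nodup,
    Walk.length_support, Nat.add_sub_cancel]

open scoped Classical in
theorem SimpleGraph.IsTree.dist_eq_card_filter {T : SimpleGraph V} (hT : T.IsTree) (v w : V) :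
    T.dist v w = #{z ∈ Finset.univ.erase v | w ∈ subtreeSet T v z} := by
  obtain ⟨p, hp, hlen⟩ := hT.connected.exists_path_of_dist w v
  rw [dist_comm, ← hlen, ← hp.card_support_erase_end]
  congr 1
  ext z
  simp [hT.mem_subtreeSet_iff ⟨p, hp⟩]

theorem SimpleGraph.IsTree.closeness_eq_sum_subtreeCard {T : SimpleGraph V} (hT : T.IsTree)
    (v : V) : closeness T v = ∑ w ∈ Finset.univ.erase v, subtreeCard T v w := by
  classical
  calc closeness T v = ∑ w, T.dist v w := Finset.sum_erase _ dist_self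
    _ = ∑ w, #{z ∈ Finset.univ.erase v | w ∈ subtreeSet T v z} :=
      Finset.sum_congr rfl fun w _ => hT.dist_eq_card_filter v w
    _ = ∑ z ∈ Finset.univ.erase v, #{w | w ∈ subtreeSet T v z} :=
      Finset.sum_card_bipartiteAbove_eq_sum_card_bipartiteBelow _
    _ = ∑ z ∈ Finset.univ.erase v, subtreeCard T v z :=
      Finset.sum_congr rfl fun z _ => by
        rw [subtreeCard, Nat.card_eq_fintype_card, Fintype.card_subtype]

/-- For adjacent vertices `u, v` of a finite tree: `C_T(u) ≤ C_T(v)` iff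
`|(T,v)_{u↓}| ≥ |(T,u)_{v↓}|`, likewise for rumor centrality `φ_T`; and
`C_T(v) = Σ_{w ≠ v} |(T,v)_{w↓}|`. -/
theorem closeness_rumor_adjacent (T : SimpleGraph V) (hT : T.IsTree)
    (u v : V) (hadj : T.Adj u v) :
    (closeness T u ≤ closeness T v ↔ subtreeCard T u v ≤ subtreeCard T v u) ∧
    (rumor T u ≤ rumor T v ↔ subtreeCard T u v ≤ subtreeCard T v u) ∧
    closeness T v = ∑ w ∈ Finset.univ.erase v, subtreeCard T v w := by
  have hu : u ∈ Finset.univ.erase v := by simp [hadj.ne]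
  have hv : v ∈ Finset.univ.erase u := by simp [hadj.ne']
  have hrest : ∀ z ∈ (Finset.univ.erase v).erase u, subtreeCard T v z = subtreeCard T u z := by
    intro z hz
    simp only [Finset.mem_erase] at hz
    exact subtreeCard_eq_of_adj hadj hz.1 hz.2.1
  refine ⟨?_, ?_, hT.closeness_eq_sum_subtreeCard v⟩
  · rw [hT.closeness_eq_sum_subtreeCard, hT.closeness_eq_sum_subtreeCard,
      ← Finset.add_sum_erase _ _ hu, ← Finset.add_sum_erase _ _ hv, Finset.sum_congr rfl hrest,
      Finset.erase_right_comm, add_le_add_iff_right]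
  · rw [rumor, rumor, ← Finset.mul_prod_erase _ _ hu, ← Finset.mul_prod_erase _ _ hv,
      Finset.prod_congr rfl hrest, Finset.erase_right_comm,
      mul_le_mul_iff_left₀ (Finset.prod_pos fun z _ => subtreeCard_pos T u z)]
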